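/- arXiv:1001.0377 — 2 statements merged into one kernel-verified Lean document; each statement's English description precedes it below -/
import Mathlib

section
/- Let p > 1 and q > 0. Then for every t ∈ ℝ, sn_{pq}(t,k) converges to sin_{p/2,q}(t) as k → 1−. Here, if p > 2 then sin_{p/2,q} is the extended generalized sine function with parameters (p/2, q) (periodic of period 2π_{p/2,q}), while if 1 < p ≤ 2 (so that 0 < p/2 ≤ 1) then sin_{p/2,q} is the odd extension to ℝ of the inverse of the strictly increasing function arcsin_{p/2,q} : [0,1) → [0,∞), σ ↦ ∫_0^σ (1−s^q)^{−2/p} ds. -/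
open Real Set Filter MeasureTheory

/-- Generalized arcsine: `arcsin_{pq}(σ) = ∫_0^σ (1 - s^q)^(-1/p) ds`. -/
noncomputable def arcsinPQ (p q σ : ℝ) : ℝ :=
  ∫ s in (0:ℝ)..σ, (1 - s ^ q) ^ (-(1 / p))

/-- The generalized half-period `π_{pq} = 2 arcsin_{pq}(1)`. -/
noncomputable def piPQ (p q : ℝ) : ℝ := 2 * arcsinPQ p q 1

/-- Generalized incomplete elliptic integral:
`arcsn_{pq}(σ,k) = ∫_0^σ ((1-s^q)(1-k^q s^q))^(-1/p) ds`. -/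
noncomputable def arcsnPQ (p q k σ : ℝ) : ℝ :=
  ∫ s in (0:ℝ)..σ, ((1 - s ^ q) * (1 - k ^ q * s ^ q)) ^ (-(1 / p))

/-- Generalized complete elliptic integral `K_{pq}(k) = arcsn_{pq}(1,k)`. -/
noncomputable def Kpq (p q k : ℝ) : ℝ := arcsnPQ p q k 1

/-- `φ_m(s) = |s|^(m-2) s` for `s ≠ 0`, `φ_m(0) = 0`. -/
noncomputable def phi (m s : ℝ) : ℝ := if s = 0 then 0 else |s| ^ (m - 2) * s

/-- Incomplete beta function `B̃(a,b,u) = ∫_0^u z^(a-1) (1-z)^(b-1) dz`. -/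
noncomputable def incBeta (a b u : ℝ) : ℝ :=
  ∫ z in (0:ℝ)..u, z ^ (a - 1) * (1 - z) ^ (b - 1)

/-- A classical solution of `(φ_p(u'))' + λ φ_q(u) = 0` on `(0,T)` with
`u(0) = u(T) = 0`: `u ∈ C¹([0,T])`, `t ↦ φ_p(u'(t))` is differentiable on `(0,T)`
and the equation holds at every point of `(0,T)`. -/
def IsSolE (p q T lam : ℝ) (u : ℝ → ℝ) : Prop :=
  ∃ u' : ℝ → ℝ,
    (∀ t ∈ Set.Icc 0 T, HasDerivWithinAt u (u' t) (Set.Icc 0 T) t) ∧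
    ContinuousOn u' (Set.Icc 0 T) ∧
    (∀ t ∈ Set.Ioo 0 T, HasDerivWithinAt (fun s => phi p (u' s))
      (-(lam * phi q (u t))) (Set.Ioo 0 T) t) ∧
    u 0 = 0 ∧ u T = 0

/-- A classical solution of `(φ_p(u'))' + λ φ_q(u)(1 - |u|^q) = 0` on `(0,T)` with
`u(0) = u(T) = 0`. -/
def IsSolP (p q T lam : ℝ) (u : ℝ → ℝ) : Prop :=
  ∃ u' : ℝ → ℝ,
    (∀ t ∈ Set.Icc 0 T, HasDerivWithinAt u (u' t) (Set.Icc 0 T) t) ∧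
    ContinuousOn u' (Set.Icc 0 T) ∧
    (∀ t ∈ Set.Ioo 0 T, HasDerivWithinAt (fun s => phi p (u' s))
      (-(lam * phi q (u t) * (1 - |u t| ^ q))) (Set.Ioo 0 T) t) ∧
    u 0 = 0 ∧ u T = 0

/-- `Φ(k) = (1+k^q)^(1/p) (2k^q/(1+k^q))^(1/q - 1/p) K_{pq}(k)`. -/
noncomputable def PhiFun (p q k : ℝ) : ℝ :=
  (1 + k ^ q) ^ (1 / p) * (2 * k ^ q / (1 + k ^ q)) ^ (1 / q - 1 / p) * Kpq p q k

lemma one_sub_rpow_pos {q s : ℝ} (hq : 0 < q) (hs : 0 ≤ s) (hs1 : s < 1) : 0 < 1 - s ^ q :=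
  sub_pos.2 (Real.rpow_lt_one hs hs1 hq)

lemma min_mul_one_sub_le_one_sub_rpow {q s : ℝ} (hq : 0 < q) (hs : 0 ≤ s) (hs1 : s ≤ 1) :
    min q 1 * (1 - s) ≤ 1 - s ^ q := by
  rcases le_total q 1 with h | h
  · rw [min_eq_left h]
    have := rpow_one_add_le_one_add_mul_self (s := s - 1) (by linarith) hq.le h
    rw [add_sub_cancel] at this
    linarith
  · rw [min_eq_right h]
    have := Real.rpow_le_rpow_of_exponent_ge' hs hs1 zero_le_one h
    rw [Real.rpow_one] at this
    linarith

lemma one_sub_rpow_le_max_mul_one_sub {q s : ℝ} (hq : 0 < q) (hs : 0 ≤ s) (hs1 : s ≤ 1) :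
    1 - s ^ q ≤ max q 1 * (1 - s) := by
  rcases le_total q 1 with h | h
  · rw [max_eq_right h]
    have := Real.rpow_le_rpow_of_exponent_ge' hs hs1 hq.le h
    rw [Real.rpow_one] at this
    linarith
  · rw [max_eq_left h]
    have := one_add_mul_self_le_rpow_one_add (s := s - 1) (by linarith) h
    rw [add_sub_cancel] at this
    linarith

lemma intervalIntegrable_one_sub_rpow_rpow_neg {q r : ℝ} (hq : 0 < q) (hr : 0 < r) (hr1 : r < 1) :
    IntervalIntegrable (fun s : ℝ => (1 - s ^ q) ^ (-r)) volume 0 1 := by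
  have h1 : IntervalIntegrable (fun s : ℝ => (min q 1) ^ (-r) * (1 - s) ^ (-r)) volume 0 1 := by
    have := (intervalIntegral.intervalIntegrable_rpow' (a := 0) (b := 1) (r := -r)
      (by linarith)).comp_sub_left 1
    simp only [sub_zero, sub_self] at this
    exact this.symm.const_mul _
  have hm : 0 < min q 1 := lt_min hq one_pos
  refine h1.mono_fun (Measurable.aestronglyMeasurable (by fun_prop)) ?_
  rw [Filter.EventuallyLE, ae_restrict_iff' measurableSet_uIoc]
  filter_upwards [Measure.ae_ne volume (1 : ℝ)] with s hs1 hs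
  rw [uIoc_of_le zero_le_one] at hs
  have hlt : s < 1 := lt_of_le_of_ne hs.2 hs1
  have hpos : 0 < 1 - s := by linarith
  rw [Real.norm_of_nonneg (Real.rpow_nonneg (one_sub_rpow_pos hq hs.1.le hlt).le _),
    ← Real.mul_rpow hm.le hpos.le, Real.norm_of_nonneg (by positivity)]
  exact Real.rpow_le_rpow_of_nonpos (by positivity)
    (min_mul_one_sub_le_one_sub_rpow hq hs.1.le hs.2) (by linarith)

lemma intervalIntegrable_one_sub_rpow_rpow {q r σ : ℝ} (hq : 0 < q) (hσ : 0 ≤ σ) (hσ1 : σ < 1) :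
    IntervalIntegrable (fun s : ℝ => (1 - s ^ q) ^ r) volume 0 σ := by
  refine ContinuousOn.intervalIntegrable fun s hs => ContinuousAt.continuousWithinAt ?_
  rw [uIcc_of_le hσ] at hs
  exact (continuousAt_const.sub (Real.continuousAt_rpow_const s q (Or.inr hq.le))).rpow_const
    (Or.inl (one_sub_rpow_pos hq hs.1 (hs.2.trans_lt hσ1)).ne')

lemma one_sub_rpow_le_one_sub_mul {q k s : ℝ} (hq : 0 < q) (hk : 0 ≤ k) (hk1 : k ≤ 1)
    (hs : 0 ≤ s) : 1 - s ^ q ≤ 1 - k ^ q * s ^ q := by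
  have := mul_le_mul_of_nonneg_right (Real.rpow_le_one hk hk1 hq.le) (Real.rpow_nonneg hs q)
  linarith

lemma one_le_arcsnPQ_integrand {p q k s : ℝ} (hp : 0 < p) (hq : 0 < q) (hk : 0 ≤ k) (hk1 : k ≤ 1)
    (hs : 0 ≤ s) (hs1 : s < 1) :
    1 ≤ ((1 - s ^ q) * (1 - k ^ q * s ^ q)) ^ (-(1 / p)) := by
  have h1 := one_sub_rpow_pos hq hs hs1
  have h2 := h1.trans_le (one_sub_rpow_le_one_sub_mul hq hk hk1 hs)
  have h3 := Real.rpow_nonneg hs q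
  have h4 := mul_nonneg (Real.rpow_nonneg hk q) h3
  refine Real.one_le_rpow_of_pos_of_le_one_of_nonpos (by positivity)
    (mul_le_one₀ (by linarith) h2.le (by linarith)) ?_
  have := one_div_pos.2 hp
  linarith

lemma one_sub_rpow_rpow_two_div {p q s : ℝ} (hq : 0 < q) (hs : 0 ≤ s) (hs1 : s < 1) :
    (1 - s ^ q) ^ (-(1 / (p / 2))) = ((1 - s ^ q) * (1 - s ^ q)) ^ (-(1 / p)) := by
  have h1 := one_sub_rpow_pos hq hs hs1
  rw [Real.mul_rpow h1.le h1.le, ← Real.rpow_add h1]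
  congr 1
  rw [one_div_div]
  ring

lemma arcsnPQ_integrand_le {p q k s : ℝ} (hp : 0 < p) (hq : 0 < q) (hk : 0 ≤ k) (hk1 : k ≤ 1)
    (hs : 0 ≤ s) (hs1 : s < 1) :
    ((1 - s ^ q) * (1 - k ^ q * s ^ q)) ^ (-(1 / p)) ≤ (1 - s ^ q) ^ (-(1 / (p / 2))) := by
  have h1 := one_sub_rpow_pos hq hs hs1
  rw [one_sub_rpow_rpow_two_div hq hs hs1]
  refine Real.rpow_le_rpow_of_nonpos (by positivity)
    (mul_le_mul_of_nonneg_left (one_sub_rpow_le_one_sub_mul hq hk hk1 hs) h1.le) ?_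
  have := one_div_pos.2 hp
  linarith

lemma intervalIntegrable_arcsnPQ_integrand {p q k : ℝ} (hp : 1 < p) (hq : 0 < q)
    (hk : k ∈ Ico (0 : ℝ) 1) :
    IntervalIntegrable (fun s : ℝ => ((1 - s ^ q) * (1 - k ^ q * s ^ q)) ^ (-(1 / p)))
      volume 0 1 := by
  have hpos : ∀ s ∈ Icc (0 : ℝ) 1, 0 < 1 - k ^ q * s ^ q := fun s hs => by
    have h1 := mul_le_of_le_one_right (Real.rpow_nonneg hk.1 q)
      (Real.rpow_le_one hs.1 hs.2 hq.le)
    have h2 := one_sub_rpow_pos hq hk.1 hk.2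
    linarith
  have hc : ContinuousOn (fun s : ℝ => (1 - k ^ q * s ^ q) ^ (-(1 / p))) (uIcc 0 1) := by
    intro s hs
    rw [uIcc_of_le zero_le_one] at hs
    exact ((continuousAt_const.sub (continuousAt_const.mul
      (Real.continuousAt_rpow_const s q (Or.inr hq.le)))).rpow_const
      (Or.inl (hpos s hs).ne')).continuousWithinAt
  refine ((intervalIntegrable_one_sub_rpow_rpow_neg hq (one_div_pos.2 (by linarith))
    ((div_lt_one (by linarith)).2 hp)).mul_continuousOn hc).congr fun s hs => ?_
  rw [uIoc_of_le zero_le_one] at hs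
  exact (Real.mul_rpow (sub_nonneg.2 (Real.rpow_le_one hs.1.le hs.2 hq.le))
    (hpos s ⟨hs.1.le, hs.2⟩).le).symm

lemma continuousOn_arcsnPQ {p q k : ℝ} (hp : 1 < p) (hq : 0 < q) (hk : k ∈ Ico (0 : ℝ) 1) :
    ContinuousOn (arcsnPQ p q k) (Icc 0 1) := by
  have := intervalIntegral.continuousOn_primitive_interval'
    (intervalIntegrable_arcsnPQ_integrand hp hq hk) left_mem_uIcc
  rwa [uIcc_of_le zero_le_one] at this

@[simp] lemma arcsnPQ_zero (p q k : ℝ) : arcsnPQ p q k 0 = 0 := intervalIntegral.integral_same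

@[simp] lemma arcsinPQ_zero (p q : ℝ) : arcsinPQ p q 0 = 0 := intervalIntegral.integral_same

lemma sub_le_arcsnPQ_sub {p q k a b : ℝ} (hp : 1 < p) (hq : 0 < q) (hk : k ∈ Ico (0 : ℝ) 1)
    (ha : 0 ≤ a) (hab : a ≤ b) (hb : b ≤ 1) : b - a ≤ arcsnPQ p q k b - arcsnPQ p q k a := by
  have hi := intervalIntegrable_arcsnPQ_integrand hp hq hk
  have hsub : ∀ x ∈ Icc (0 : ℝ) 1, ∀ y ∈ Icc (0 : ℝ) 1, IntervalIntegrable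
      (fun s : ℝ => ((1 - s ^ q) * (1 - k ^ q * s ^ q)) ^ (-(1 / p))) volume x y := by
    intro x hx y hy
    rw [← uIcc_of_le (zero_le_one' ℝ)] at hx hy
    exact hi.mono_set (uIcc_subset_uIcc hx hy)
  have h0 : (0 : ℝ) ∈ Icc (0 : ℝ) 1 := ⟨le_rfl, zero_le_one⟩
  have ha' : a ∈ Icc (0 : ℝ) 1 := ⟨ha, hab.trans hb⟩
  have hb' : b ∈ Icc (0 : ℝ) 1 := ⟨ha.trans hab, hb⟩
  rw [arcsnPQ, arcsnPQ, intervalIntegral.integral_interval_sub_left (hsub _ h0 _ hb')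
    (hsub _ h0 _ ha')]
  calc b - a = ∫ _ in a..b, (1 : ℝ) := by simp
    _ ≤ _ := intervalIntegral.integral_mono_on_of_le_Ioo hab intervalIntegrable_const
      (hsub _ ha' _ hb') fun s hs => one_le_arcsnPQ_integrand (by linarith) hq hk.1 hk.2.le
        (ha.trans hs.1.le) (hs.2.trans_le hb)

lemma arcsnPQ_mem_Icc {p q k σ : ℝ} (hp : 1 < p) (hq : 0 < q) (hk : k ∈ Ico (0 : ℝ) 1)
    (hσ : σ ∈ Icc (0 : ℝ) 1) : arcsnPQ p q k σ ∈ Icc 0 (Kpq p q k) := by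
  have h1 := sub_le_arcsnPQ_sub hp hq hk le_rfl hσ.1 hσ.2
  have h2 := sub_le_arcsnPQ_sub hp hq hk hσ.1 hσ.2 le_rfl
  rw [arcsnPQ_zero] at h1
  rw [Kpq]
  exact ⟨by linarith [hσ.1], by linarith [hσ.2]⟩

lemma one_le_Kpq {p q k : ℝ} (hp : 1 < p) (hq : 0 < q) (hk : k ∈ Ico (0 : ℝ) 1) :
    1 ≤ Kpq p q k := by
  have := sub_le_arcsnPQ_sub hp hq hk le_rfl zero_le_one le_rfl
  rw [arcsnPQ_zero] at this
  rw [Kpq]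
  linarith

/-- A left inverse of `arcsnPQ p q k` is `1`-Lipschitz on `[0, Kpq p q k]`. -/
lemma abs_sub_le_of_leftInverse_arcsnPQ {p q k : ℝ} (hp : 1 < p) (hq : 0 < q)
    (hk : k ∈ Ico (0 : ℝ) 1) {f : ℝ → ℝ} (hf : ∀ σ ∈ Icc (0 : ℝ) 1, f (arcsnPQ p q k σ) = σ)
    {x y : ℝ} (hx : x ∈ Icc 0 (Kpq p q k)) (hy : y ∈ Icc 0 (Kpq p q k)) :
    |f x - f y| ≤ |x - y| := by
  have hsurj : ∀ z ∈ Icc 0 (Kpq p q k), ∃ σ ∈ Icc (0 : ℝ) 1, arcsnPQ p q k σ = z := by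
    intro z hz
    refine intermediate_value_Icc zero_le_one (continuousOn_arcsnPQ hp hq hk) ?_
    rwa [arcsnPQ_zero]
  obtain ⟨a, ha, rfl⟩ := hsurj x hx
  obtain ⟨b, hb, rfl⟩ := hsurj y hy
  rw [hf a ha, hf b hb]
  rcases le_total a b with h | h
  · rw [abs_sub_comm, abs_of_nonneg (sub_nonneg.2 h), abs_sub_comm]
    exact (sub_le_arcsnPQ_sub hp hq hk ha.1 h hb.2).trans (le_abs_self _)
  · rw [abs_of_nonneg (sub_nonneg.2 h)]
    exact (sub_le_arcsnPQ_sub hp hq hk hb.1 h ha.2).trans (le_abs_self _)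

lemma abs_sub_le_of_odd_of_reflection {f : ℝ → ℝ} {K : ℝ}
    (hodd : ∀ t, f (-t) = -f t) (hrefl : ∀ t ∈ Icc K (2 * K), f t = f (2 * K - t))
    (hlip : ∀ x ∈ Icc 0 K, ∀ y ∈ Icc 0 K, |f x - f y| ≤ |x - y|)
    {x y : ℝ} (hx : |x| ≤ 2 * K) (hy : |y| ≤ 2 * K) : |f x - f y| ≤ |x - y| := by
  have hfold : ∀ z ∈ Icc 0 (2 * K), f z = f (K - |z - K|) ∧ K - |z - K| ∈ Icc 0 K := by
    intro z hz
    rcases le_total z K with h | h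
    · rw [abs_of_nonpos (by linarith)]
      refine ⟨by congr 1; ring, by linarith [hz.1], by linarith⟩
    · rw [abs_of_nonneg (by linarith), hrefl z ⟨h, hz.2⟩]
      refine ⟨by congr 1; ring, by linarith [hz.2], by linarith⟩
  have hpos : ∀ x ∈ Icc 0 (2 * K), ∀ y ∈ Icc 0 (2 * K), |f x - f y| ≤ |x - y| := by
    intro x hx y hy
    rw [(hfold x hx).1, (hfold y hy).1]
    refine (hlip _ (hfold x hx).2 _ (hfold y hy).2).trans ?_
    calc |K - |x - K| - (K - |y - K|)| = |(|y - K| - |x - K|)| := by congr 1; ring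
      _ ≤ |y - K - (x - K)| := abs_abs_sub_abs_le _ _
      _ = |x - y| := by rw [abs_sub_comm x y]; congr 1; ring
  have hf0 : f 0 = 0 := by
    have := hodd 0
    rw [neg_zero] at this
    linarith
  have hopp : ∀ x ∈ Icc 0 (2 * K), ∀ y ∈ Icc 0 (2 * K), |f x - f (-y)| ≤ x + y := by
    intro x hx y hy
    have h0 : (0 : ℝ) ∈ Icc 0 (2 * K) := ⟨le_rfl, hx.1.trans hx.2⟩
    have h1 := hpos x hx 0 h0
    have h2 := hpos y hy 0 h0
    rw [hf0, sub_zero, sub_zero] at h1 h2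
    rw [abs_of_nonneg hx.1] at h1
    rw [abs_of_nonneg hy.1] at h2
    rw [hodd, sub_neg_eq_add]
    exact (abs_add_le _ _).trans (add_le_add h1 h2)
  obtain ⟨hx1, hx2⟩ := abs_le.1 hx
  obtain ⟨hy1, hy2⟩ := abs_le.1 hy
  rcases le_total 0 x with h | h <;> rcases le_total 0 y with h' | h'
  · exact hpos x ⟨h, hx2⟩ y ⟨h', hy2⟩
  · have := hopp x ⟨h, hx2⟩ (-y) ⟨by linarith, by linarith⟩
    rw [neg_neg] at this
    exact this.trans (by rw [← sub_eq_add_neg]; exact le_abs_self _)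
  · have := hopp y ⟨h', hy2⟩ (-x) ⟨by linarith, by linarith⟩
    rw [neg_neg, abs_sub_comm] at this
    exact this.trans (by rw [← sub_eq_add_neg, abs_sub_comm]; exact le_abs_self _)
  · have := hpos (-x) ⟨by linarith, by linarith⟩ (-y) ⟨by linarith, by linarith⟩
    rw [hodd, hodd, ← abs_neg, ← abs_neg (-x - -y)] at this
    convert this using 2 <;> ring

lemma antiperiodic_of_odd_of_reflection {f : ℝ → ℝ} {K : ℝ} (hK : 0 < K)
    (hodd : ∀ t, f (-t) = -f t) (hrefl : ∀ t ∈ Icc K (2 * K), f t = f (2 * K - t))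
    (hper : Function.Periodic f (4 * K)) : Function.Antiperiodic f (2 * K) := by
  have h1 : ∀ t ∈ Icc 0 (2 * K), f (2 * K - t) = f t := by
    intro t ht
    rcases le_total t K with h | h
    · rw [hrefl (2 * K - t) ⟨by linarith, by linarith [ht.1]⟩]
      congr 1
      ring
    · exact (hrefl t ⟨h, ht.2⟩).symm
  have h2 : ∀ t ∈ Icc (-(2 * K)) (2 * K), f (2 * K - t) = f t := by
    intro t ht
    rcases le_total 0 t with h | h
    · exact h1 t ⟨h, ht.2⟩
    · have e1 := h1 (-t) ⟨by linarith, by linarith [ht.1]⟩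
      have e2 := hper (-(2 * K + t))
      rw [sub_neg_eq_add, hodd] at e1
      rw [hodd, e1, neg_neg] at e2
      rw [← e2]
      congr 1
      ring
  have h3 : ∀ t, f (2 * K - t) = f t := by
    intro t
    obtain ⟨n, hn, -⟩ := existsUnique_sub_zsmul_mem_Ico (by linarith : 0 < 4 * K) t (-(2 * K))
    have e := h2 (t - n • (4 * K)) ⟨hn.1, by linarith [hn.2]⟩
    rwa [hper.sub_zsmul_eq, sub_sub_eq_add_sub, add_sub_right_comm, hper.zsmul n] at e
  intro t
  rw [← hodd, ← h3 (-t), sub_neg_eq_add, add_comm]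

lemma tendsto_arcsnPQ {p q σ : ℝ} (hp : 1 < p) (hq : 0 < q) (hσ : σ ∈ Icc (0 : ℝ) 1)
    (hi : IntervalIntegrable (fun s : ℝ => (1 - s ^ q) ^ (-(1 / (p / 2)))) volume 0 σ) :
    Tendsto (fun k => arcsnPQ p q k σ) (nhdsWithin 1 (Iio 1)) (nhds (arcsinPQ (p / 2) q σ)) := by
  have hk : ∀ᶠ k in nhdsWithin (1 : ℝ) (Iio 1), k ∈ Ico (0 : ℝ) 1 :=
    Ico_mem_nhdsLT zero_lt_one
  refine intervalIntegral.tendsto_integral_filter_of_dominated_convergence _ ?_ ?_ hi ?_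
  · exact Eventually.of_forall fun k => Measurable.aestronglyMeasurable (by fun_prop)
  · filter_upwards [hk] with k hk
    filter_upwards [Measure.ae_ne volume (1 : ℝ)] with s hs1 hs
    rw [uIoc_of_le hσ.1] at hs
    have hlt : s < 1 := lt_of_le_of_ne (hs.2.trans hσ.2) hs1
    rw [Real.norm_of_nonneg (zero_le_one.trans
      (one_le_arcsnPQ_integrand (by linarith) hq hk.1 hk.2.le hs.1.le hlt))]
    exact arcsnPQ_integrand_le (by linarith) hq hk.1 hk.2.le hs.1.le hlt
  · filter_upwards [Measure.ae_ne volume (1 : ℝ)] with s hs1 hs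
    rw [uIoc_of_le hσ.1] at hs
    have hlt : s < 1 := lt_of_le_of_ne (hs.2.trans hσ.2) hs1
    have h1 := one_sub_rpow_pos hq hs.1.le hlt
    rw [one_sub_rpow_rpow_two_div hq hs.1.le hlt]
    have hc : ContinuousAt (fun k : ℝ => ((1 - s ^ q) * (1 - k ^ q * s ^ q)) ^ (-(1 / p))) 1 := by
      refine (continuousAt_const.mul (continuousAt_const.sub
        ((Real.continuousAt_rpow_const 1 q (Or.inr hq.le)).mul
          continuousAt_const))).rpow_const (Or.inl ?_)
      simpa using h1.ne'
    have := hc.tendsto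
    rw [Real.one_rpow, one_mul] at this
    exact this.mono_left nhdsWithin_le_nhds

/-- For `r ≤ 1` the generalized arcsine maps `[0, 1)` onto `[0, ∞)`. -/
lemma exists_arcsinPQ_eq {r q t : ℝ} (hr : 0 < r) (hr1 : r ≤ 1) (hq : 0 < q) (ht : 0 ≤ t) :
    ∃ σ ∈ Ico (0 : ℝ) 1, arcsinPQ r q σ = t := by
  set C := max q 1
  have hC0 : 0 < C := lt_max_of_lt_left hq
  set τ := 1 - Real.exp (-(C * t)) with hτ
  have hτ1 : τ < 1 := by linarith [Real.exp_pos (-(C * t))]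
  have hτ0 : 0 ≤ τ := by
    have : Real.exp (-(C * t)) ≤ 1 := Real.exp_le_one_iff.2 (neg_nonpos.2 (by positivity))
    linarith
  have hi := intervalIntegrable_one_sub_rpow_rpow (r := -(1 / r)) hq hτ0 hτ1
  have hle : t ≤ arcsinPQ r q τ := by
    have hlog : ∫ s in (0 : ℝ)..τ, C⁻¹ * (1 - s)⁻¹ = t := by
      rw [intervalIntegral.integral_const_mul,
        intervalIntegral.integral_comp_sub_left (fun x : ℝ => x⁻¹) 1, sub_zero,
        integral_inv_of_pos (by linarith) one_pos, hτ, sub_sub_cancel, one_div, ← Real.exp_neg,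
        neg_neg, Real.log_exp]
      field_simp
    rw [← hlog]
    refine intervalIntegral.integral_mono_on hτ0 ?_ hi fun s hs => ?_
    · refine ContinuousOn.intervalIntegrable fun s hs => ContinuousAt.continuousWithinAt ?_
      rw [uIcc_of_le hτ0] at hs
      exact continuousAt_const.mul ((continuousAt_const.sub continuousAt_id).inv₀
        (sub_pos.2 (hs.2.trans_lt hτ1)).ne')
    · have hs1 : s < 1 := hs.2.trans_lt hτ1
      have h1 := one_sub_rpow_pos hq hs.1 hs1
      calc C⁻¹ * (1 - s)⁻¹ = (C * (1 - s))⁻¹ := (mul_inv _ _).symm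
        _ ≤ (1 - s ^ q)⁻¹ := inv_anti₀ h1 (one_sub_rpow_le_max_mul_one_sub hq hs.1 hs1.le)
        _ = (1 - s ^ q) ^ (-1 : ℝ) := (Real.rpow_neg_one _).symm
        _ ≤ _ := Real.rpow_le_rpow_of_exponent_ge h1
          (by linarith [Real.rpow_nonneg hs.1 q]) (by linarith [(one_le_div hr).2 hr1])
  have hcont : ContinuousOn (arcsinPQ r q) (Icc 0 τ) := by
    have := intervalIntegral.continuousOn_primitive_interval' hi left_mem_uIcc
    rwa [uIcc_of_le hτ0] at this
  obtain ⟨σ, hσ, h⟩ := intermediate_value_Icc hτ0 hcont ⟨by rwa [arcsinPQ_zero], hle⟩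
  exact ⟨σ, ⟨hσ.1, hσ.2.trans_lt hτ1⟩, h⟩

/-- Convergence of `sn k (s k)` when `s k` approaches the limit of `arcsnPQ p q k σ`. -/
lemma tendsto_sn_of_tendsto_arcsnPQ {p q σ T : ℝ} (hp : 1 < p) (hq : 0 < q) {sn : ℝ → ℝ → ℝ}
    (hinv : ∀ k ∈ Ico (0 : ℝ) 1, ∀ σ ∈ Icc (0 : ℝ) 1, sn k (arcsnPQ p q k σ) = σ)
    (hrefl : ∀ k ∈ Ico (0 : ℝ) 1, ∀ t ∈ Icc (Kpq p q k) (2 * Kpq p q k),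
      sn k t = sn k (2 * Kpq p q k - t))
    (hodd : ∀ k ∈ Ico (0 : ℝ) 1, ∀ t : ℝ, sn k (-t) = -sn k t)
    (hσ : σ ∈ Icc (0 : ℝ) 1)
    (hT : Tendsto (fun k => arcsnPQ p q k σ) (nhdsWithin 1 (Iio 1)) (nhds T))
    {s : ℝ → ℝ} (hs : Tendsto s (nhdsWithin 1 (Iio 1)) (nhds T))
    (hsK : ∀ᶠ k in nhdsWithin 1 (Iio 1), |s k| ≤ 2 * Kpq p q k) :
    Tendsto (fun k => sn k (s k)) (nhdsWithin 1 (Iio 1)) (nhds σ) := by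
  rw [tendsto_iff_dist_tendsto_zero]
  have h0 : Tendsto (fun k => |s k - arcsnPQ p q k σ|) (nhdsWithin 1 (Iio 1)) (nhds 0) := by
    simpa using (hs.sub hT).abs
  refine squeeze_zero' (Eventually.of_forall fun k => dist_nonneg) ?_ h0
  filter_upwards [hsK, Ico_mem_nhdsLT zero_lt_one] with k hsk hk
  have hmem := arcsnPQ_mem_Icc hp hq hk hσ
  rw [Real.dist_eq]
  nth_rw 1 [← hinv k hk σ hσ]
  refine abs_sub_le_of_odd_of_reflection (hodd k hk) (hrefl k hk)
    (fun x hx y hy => abs_sub_le_of_leftInverse_arcsnPQ hp hq hk (hinv k hk) hx hy) hsk ?_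
  rw [abs_of_nonneg hmem.1]
  linarith [hmem.1, hmem.2]

theorem stmt7 (p q : ℝ) (hp : 1 < p) (hq : 0 < q)
    (sn : ℝ → ℝ → ℝ) (sin2 : ℝ → ℝ)
    (hsn_inv : ∀ k ∈ Ico (0:ℝ) 1, ∀ σ ∈ Icc (0:ℝ) 1, sn k (arcsnPQ p q k σ) = σ)
    (hsn_refl : ∀ k ∈ Ico (0:ℝ) 1, ∀ t ∈ Icc (Kpq p q k) (2 * Kpq p q k),
      sn k t = sn k (2 * Kpq p q k - t))
    (hsn_odd : ∀ k ∈ Ico (0:ℝ) 1, ∀ t : ℝ, sn k (-t) = - sn k t)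
    (hsn_per : ∀ k ∈ Ico (0:ℝ) 1, ∀ t : ℝ, sn k (t + 4 * Kpq p q k) = sn k t)
    (hgt2 : 2 < p →
      (∀ σ ∈ Icc (0:ℝ) 1, sin2 (arcsinPQ (p / 2) q σ) = σ) ∧
      (∀ t ∈ Icc (piPQ (p / 2) q / 2) (piPQ (p / 2) q),
        sin2 t = sin2 (piPQ (p / 2) q - t)) ∧
      (∀ t : ℝ, sin2 (-t) = - sin2 t) ∧
      (∀ t : ℝ, sin2 (t + 2 * piPQ (p / 2) q) = sin2 t))
    (hle2 : p ≤ 2 →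
      (∀ σ ∈ Ico (0:ℝ) 1, sin2 (arcsinPQ (p / 2) q σ) = σ) ∧
      (∀ t : ℝ, sin2 (-t) = - sin2 t)) :
    ∀ t : ℝ, Tendsto (fun k => sn k t) (nhdsWithin 1 (Iio 1)) (nhds (sin2 t)) := by
  have hIco : ∀ᶠ k in nhdsWithin (1 : ℝ) (Iio 1), k ∈ Ico (0 : ℝ) 1 :=
    Ico_mem_nhdsLT zero_lt_one
  rcases le_or_gt p 2 with hp2 | hp2
  · obtain ⟨hinv, hodd⟩ := hle2 hp2
    have hint : ∀ σ ∈ Ico (0 : ℝ) 1, Tendsto (fun k => arcsnPQ p q k σ) (nhdsWithin 1 (Iio 1))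
        (nhds (arcsinPQ (p / 2) q σ)) := fun σ hσ =>
      tendsto_arcsnPQ hp hq ⟨hσ.1, hσ.2.le⟩ (intervalIntegrable_one_sub_rpow_rpow hq hσ.1 hσ.2)
    have hpos : ∀ t : ℝ, 0 ≤ t →
        Tendsto (fun k => sn k t) (nhdsWithin 1 (Iio 1)) (nhds (sin2 t)) := by
      intro t ht
      obtain ⟨σ, hσ, rfl⟩ := exists_arcsinPQ_eq (by linarith : 0 < p / 2) (by linarith) hq ht
      obtain ⟨τ, hτ, hτt⟩ := exists_arcsinPQ_eq (by linarith : 0 < p / 2) (by linarith) hq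
        (by linarith : 0 ≤ arcsinPQ (p / 2) q σ + 1)
      rw [hinv σ hσ]
      refine tendsto_sn_of_tendsto_arcsnPQ hp hq hsn_inv hsn_refl hsn_odd ⟨hσ.1, hσ.2.le⟩
        (hint σ hσ) tendsto_const_nhds ?_
      have hlt : arcsinPQ (p / 2) q σ < arcsinPQ (p / 2) q τ := by linarith
      filter_upwards [hIco, (hint τ hτ).eventually_const_lt hlt] with k hk hlt
      have := arcsnPQ_mem_Icc hp hq hk ⟨hτ.1, hτ.2.le⟩
      rw [abs_of_nonneg ht]
      linarith [this.1, this.2]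
    intro t
    rcases le_total 0 t with ht | ht
    · exact hpos t ht
    · have := (hpos (-t) (by linarith)).neg
      rw [hodd, neg_neg] at this
      refine this.congr' ?_
      filter_upwards [hIco] with k hk
      rw [hsn_odd k hk, neg_neg]
  · obtain ⟨hinv, hrefl, hodd, hper⟩ := hgt2 hp2
    set K := arcsinPQ (p / 2) q 1
    have hpi : piPQ (p / 2) q = 2 * K := rfl
    rw [hpi, mul_div_cancel_left₀ K two_ne_zero] at hrefl
    have hi : IntervalIntegrable (fun s : ℝ => (1 - s ^ q) ^ (-(1 / (p / 2)))) volume 0 1 :=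
      intervalIntegrable_one_sub_rpow_rpow_neg hq (by positivity)
        ((div_lt_one (by linarith)).2 (by linarith))
    have hint : ∀ σ ∈ Icc (0 : ℝ) 1, Tendsto (fun k => arcsnPQ p q k σ) (nhdsWithin 1 (Iio 1))
        (nhds (arcsinPQ (p / 2) q σ)) := fun σ hσ => by
      rw [← uIcc_of_le (zero_le_one' ℝ)] at hσ
      exact tendsto_arcsnPQ hp hq (by rwa [uIcc_of_le zero_le_one] at hσ)
        (hi.mono_set (uIcc_subset_uIcc_left hσ))
    have hKlim : Tendsto (Kpq p q) (nhdsWithin 1 (Iio 1)) (nhds K) :=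
      hint 1 ⟨zero_le_one, le_rfl⟩
    have hKpos : 0 < K := one_pos.trans_le <| ge_of_tendsto hKlim <| by
      filter_upwards [hIco] with k hk using one_le_Kpq hp hq hk
    have hanti : Function.Antiperiodic sin2 (2 * K) :=
      antiperiodic_of_odd_of_reflection hKpos hodd hrefl fun t => by
        rw [← hper t, hpi]
        congr 1
        ring
    have hsn_anti : ∀ k ∈ Ico (0 : ℝ) 1, Function.Antiperiodic (sn k) (2 * Kpq p q k) :=
      fun k hk => antiperiodic_of_odd_of_reflection (one_pos.trans_le (one_le_Kpq hp hq hk))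
        (hsn_odd k hk) (hsn_refl k hk) (hsn_per k hk)
    have hquarter : ∀ t ∈ Icc 0 K, ∀ s : ℝ → ℝ, Tendsto s (nhdsWithin 1 (Iio 1)) (nhds t) →
        Tendsto (fun k => sn k (s k)) (nhdsWithin 1 (Iio 1)) (nhds (sin2 t)) := by
      intro t ht s hs
      have hcont : ContinuousOn (arcsinPQ (p / 2) q) (Icc 0 1) := by
        have := intervalIntegral.continuousOn_primitive_interval' hi left_mem_uIcc
        rwa [uIcc_of_le zero_le_one] at this
      obtain ⟨σ, hσ, rfl⟩ := intermediate_value_Icc zero_le_one hcont (by rwa [arcsinPQ_zero])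
      rw [hinv σ hσ]
      refine tendsto_sn_of_tendsto_arcsnPQ hp hq hsn_inv hsn_refl hsn_odd hσ (hint σ hσ) hs ?_
      refine (hs.abs.eventually_lt (hKlim.const_mul 2) ?_).mono fun k hk => hk.le
      rw [abs_of_nonneg ht.1]
      linarith [ht.2]
    have hhalf : ∀ t ∈ Icc 0 (2 * K), ∀ s : ℝ → ℝ, Tendsto s (nhdsWithin 1 (Iio 1)) (nhds t) →
        Tendsto (fun k => sn k (s k)) (nhdsWithin 1 (Iio 1)) (nhds (sin2 t)) := by
      intro t ht s hs
      rcases le_total t K with h | h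
      · exact hquarter t ⟨ht.1, h⟩ s hs
      · rw [hrefl t ⟨h, ht.2⟩]
        refine (hquarter (2 * K - t) ⟨by linarith [ht.2], by linarith⟩ _
          ((hKlim.const_mul 2).sub hs)).congr' ?_
        filter_upwards [hIco] with k hk
        rw [sub_eq_neg_add, hsn_anti k hk, hsn_odd k hk, neg_neg]
    intro t
    obtain ⟨n, hn, -⟩ := existsUnique_sub_zsmul_mem_Ico (by linarith : 0 < 2 * K) t 0
    rw [zero_add] at hn
    have h := (hhalf _ ⟨hn.1, hn.2.le⟩ (fun k => t - n • (2 * Kpq p q k))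
      (tendsto_const_nhds.sub ((hKlim.const_mul 2).const_smul n))).const_smul
      ((n.negOnePow : ℤˣ) : ℤ)
    have hfold : ∀ (f : ℝ → ℝ) (c : ℝ), Function.Antiperiodic f c →
        ((n.negOnePow : ℤˣ) : ℤ) • f (t - n • c) = f t := by
      intro f c hf
      have := hf.add_zsmul_eq n (x := t - n • c)
      rw [sub_add_cancel] at this
      exact this.symm
    rw [hfold sin2 _ hanti] at h
    refine h.congr' ?_
    filter_upwards [hIco] with k hk using hfold (sn k) _ (hsn_anti k hk)
end

section
/- Let p > 1, q > 1, λ > 0 and α > 0, and set R = (q/(λp*))^{1/q}·α^{p/q}. Then the function u(t) = R·sin_{pq}((λp*/q)^{1/p}·R^{q/p−1}·t) satisfies u(0) = 0, u'(0) = α, and (φ_p(u'))' + λ·φ_q(u) = 0 at every point of ℝ in the classical sense. -/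
open Real Set Filter MeasureTheory

lemma phi_eq (m s : ℝ) : phi m s = |s| ^ (m - 2) * s := by
  unfold phi
  split_ifs with h <;> simp [h]

lemma phi_neg (m s : ℝ) : phi m (-s) = -phi m s := by
  simp [phi_eq]

lemma phi_mul_of_pos (m s : ℝ) {c : ℝ} (hc : 0 < c) : phi m (c * s) = c ^ (m - 1) * phi m s := by
  have h : c ^ (m - 1) = c ^ (m - 2) * c := by
    rw [← rpow_add_one hc.ne']
    congr 1
    ring
  rw [phi_eq, phi_eq, abs_mul, abs_of_pos hc, mul_rpow hc.le (abs_nonneg s), h]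
  ring

lemma phi_rpow_inv {p : ℝ} (hp : 1 < p) {y : ℝ} (hy : 0 ≤ y) :
    phi p (y ^ (1 / p)) = y ^ (1 - 1 / p) := by
  have hp0 : (0:ℝ) < p := by linarith
  rcases hy.eq_or_lt with rfl | hy
  · have h1 : (1 / p : ℝ) ≠ 0 := by positivity
    have h2 : (1 - 1 / p : ℝ) ≠ 0 := by
      have : 1 / p < 1 := by rw [div_lt_one hp0]; exact hp
      linarith
    rw [zero_rpow h1, zero_rpow h2]
    simp [phi]
  · rw [phi_eq, abs_of_pos (rpow_pos_of_pos hy _), ← rpow_mul hy.le, ← rpow_add hy]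
    congr 1
    field_simp
    ring

lemma continuousAt_phi (m : ℝ) {x : ℝ} (hx : x ≠ 0) : ContinuousAt (phi m) x := by
  have : phi m = fun s => |s| ^ (m - 2) * s := funext (phi_eq m)
  rw [this]
  exact (continuous_abs.continuousAt.rpow_const (Or.inl (abs_ne_zero.2 hx))).mul continuousAt_id

/-- A left inverse of a continuous function on a compact set is continuous on the image. -/
lemma IsCompact.continuousOn_image_of_leftInvOn {f g : ℝ → ℝ} {K : Set ℝ} (hK : IsCompact K)
    (hf : ContinuousOn f K) (hg : LeftInvOn g f K) : ContinuousOn g (f '' K) := by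
  rw [continuousOn_iff_isClosed]
  intro t ht
  refine ⟨f '' (K ∩ t), ((hK.inter_right ht).image_of_continuousOn
    (hf.mono inter_subset_left)).isClosed, ?_⟩
  ext y
  constructor
  · rintro ⟨hy, x, hx, rfl⟩
    rw [mem_preimage, hg hx] at hy
    exact ⟨⟨x, ⟨hx, hy⟩, rfl⟩, ⟨x, hx, rfl⟩⟩
  · rintro ⟨⟨x, ⟨hx, hxt⟩, rfl⟩, h⟩
    refine ⟨?_, h⟩
    rwa [mem_preimage, hg hx]

/-- Differentiability up to the endpoints of a closed interval, by continuity of the derivative. -/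
lemma hasDerivWithinAt_Icc_of_Ioo {f g : ℝ → ℝ} {a b : ℝ} (hab : a < b)
    (hf : ContinuousOn f (Icc a b)) (hd : ∀ t ∈ Ioo a b, HasDerivAt f (g t) t)
    (ha : ContinuousWithinAt g (Icc a b) a) (hb : ContinuousWithinAt g (Icc a b) b) :
    ∀ t ∈ Icc a b, HasDerivWithinAt f (g t) (Icc a b) t := by
  have hdiff : DifferentiableOn ℝ f (Ioo a b) := fun t ht =>
    (hd t ht).differentiableAt.differentiableWithinAt
  intro t ht
  rcases ht.1.eq_or_lt with rfl | hat
  · refine (hasDerivWithinAt_Ici_of_tendsto_deriv hdiff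
      ((hf a ht).mono Ioo_subset_Icc_self) (Ioo_mem_nhdsGT hab) ?_).mono Icc_subset_Ici_self
    have h := ha.mono_left (nhdsWithin_mono a Ioo_subset_Icc_self)
    rw [nhdsWithin_Ioo_eq_nhdsGT hab] at h
    refine h.congr' ?_
    filter_upwards [Ioo_mem_nhdsGT hab] with x hx using (hd x hx).deriv.symm
  rcases ht.2.eq_or_lt with rfl | htb
  · refine (hasDerivWithinAt_Iic_of_tendsto_deriv hdiff
      ((hf t ht).mono Ioo_subset_Icc_self) (Ioo_mem_nhdsLT hab) ?_).mono Icc_subset_Iic_self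
    have h := hb.mono_left (nhdsWithin_mono t Ioo_subset_Icc_self)
    rw [nhdsWithin_Ioo_eq_nhdsLT hab] at h
    refine h.congr' ?_
    filter_upwards [Ioo_mem_nhdsLT hab] with x hx using (hd x hx).deriv.symm
  · exact (hd t ⟨hat, htb⟩).hasDerivWithinAt

/-- An antiperiodic function differentiable on a closed antiperiod, with matching derivatives at
the endpoints, is differentiable at the points of that interval. -/
lemma hasDerivAt_of_antiperiodic_of_Icc {f g : ℝ → ℝ} {H : ℝ} (hH : 0 < H)
    (hf : ∀ t, f (t + 2 * H) = -f t)
    (hd : ∀ t ∈ Icc (-H) H, HasDerivWithinAt f (g t) (Icc (-H) H) t) (hg : g H = -g (-H)) :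
    ∀ t ∈ Icc (-H) H, HasDerivAt f (g t) t := by
  have hright : HasDerivAt f (g H) H := by
    have h1 : HasDerivWithinAt f (g H) (Icc (-H) H) H := hd H ⟨by linarith, le_rfl⟩
    have h2 : HasDerivWithinAt f (g H) (Icc H (3 * H)) H := by
      have h3 := hd (-H) ⟨le_rfl, by linarith⟩
      have h4 : HasDerivWithinAt (fun t => f (t - 2 * H)) (g (-H)) (Icc H (3 * H)) H := by
        have h5 := HasDerivWithinAt.scomp_of_eq (h := fun t => t - 2 * H) (h' := 1) (x := H)
          (s := Icc H (3 * H)) h3 ((hasDerivWithinAt_id H _).sub_const _)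
          (fun x hx => ⟨by linarith [hx.1], by linarith [hx.2]⟩) (by ring)
        simpa [Function.comp_def] using h5
      rw [hg]
      refine h4.neg.congr_of_mem (fun x _ => ?_) ⟨le_rfl, by linarith⟩
      have := hf (x - 2 * H)
      rw [sub_add_cancel] at this
      simpa using this
    have h3 := h1.union h2
    rw [Icc_union_Icc_eq_Icc (by linarith) (by linarith)] at h3
    exact h3.hasDerivAt (Icc_mem_nhds (by linarith) (by linarith))
  intro t ht
  rcases ht.1.eq_or_lt with rfl | h1
  · have h : HasDerivAt (fun t => f (t + 2 * H)) (g H) (-H) := by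
      apply HasDerivAt.comp_add_const
      rwa [show -H + 2 * H = H by ring]
    have h' := h.neg
    rw [hg, neg_neg] at h'
    exact h'.congr_of_eventuallyEq (Eventually.of_forall fun x => by simp [hf])
  rcases ht.2.eq_or_lt with rfl | h2
  · exact hright
  · exact (hd t ht).hasDerivAt (Icc_mem_nhds h1 h2)

lemma hasDerivAt_of_antiperiodic {f g : ℝ → ℝ} {H : ℝ} (hH : 0 < H)
    (hf : ∀ t, f (t + 2 * H) = -f t) (hg : ∀ t, g (t + 2 * H) = -g t)
    (hd : ∀ t ∈ Icc (-H) H, HasDerivAt f (g t) t) (t : ℝ) : HasDerivAt f (g t) t := by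
  have hper : Function.Periodic (fun t => HasDerivAt f (g t) t) (2 * H) := by
    intro t
    refine propext ⟨fun h => ?_, fun h => ?_⟩
    · have h' := (HasDerivAt.comp_add_const t (2 * H) h).neg
      rw [hg, neg_neg] at h'
      exact h'.congr_of_eventuallyEq (Eventually.of_forall fun x => by simp [hf])
    · change HasDerivAt f (g (t + 2 * H)) (t + 2 * H)
      have h' : HasDerivAt f (g (t + 2 * H - 2 * H)) (t + 2 * H - 2 * H) := by
        rwa [add_sub_cancel_right]
      have h'' := (HasDerivAt.comp_sub_const (t + 2 * H) (2 * H) h').neg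
      rw [add_sub_cancel_right] at h''
      rw [hg]
      refine h''.congr_of_eventuallyEq (Eventually.of_forall fun x => ?_)
      have := hf (x - 2 * H)
      rw [sub_add_cancel] at this
      simpa using this
  obtain ⟨y, hy, h⟩ := hper.exists_mem_Ico (by linarith) t (-H)
  rw [h]
  exact hd y ⟨hy.1, by linarith [hy.2]⟩

/-- The odd extension of `arcsinPQ` to `[-1, 1]`. -/
noncomputable def arcsinOdd (p q σ : ℝ) : ℝ :=
  ∫ s in (0:ℝ)..σ, (1 - |s| ^ q) ^ (-(1 / p))

lemma arcsinOdd_eq {p q σ : ℝ} (hσ : 0 ≤ σ) : arcsinOdd p q σ = arcsinPQ p q σ := by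
  unfold arcsinOdd arcsinPQ
  refine intervalIntegral.integral_congr fun s hs => ?_
  rw [uIcc_of_le hσ] at hs
  simp only [abs_of_nonneg hs.1]

lemma arcsinOdd_one (p q : ℝ) : arcsinOdd p q 1 = piPQ p q / 2 := by
  rw [arcsinOdd_eq zero_le_one, piPQ]
  ring

lemma arcsinOdd_neg (p q σ : ℝ) : arcsinOdd p q (-σ) = -arcsinOdd p q σ := by
  unfold arcsinOdd
  have h := intervalIntegral.integral_comp_neg (a := 0) (b := σ)
    (fun s : ℝ => (1 - |s| ^ q) ^ (-(1 / p)))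
  simp only [abs_neg, neg_zero] at h
  rw [h, ← intervalIntegral.integral_symm]

lemma intervalIntegrable_arcsinOdd {p q : ℝ} (hp : 1 < p) (hq : 1 < q) :
    IntervalIntegrable (fun s : ℝ => (1 - |s| ^ q) ^ (-(1 / p))) volume (-1) 1 := by
  have hp0 : (0:ℝ) < p := by linarith
  have h1p : 1 / p < 1 := by rw [div_lt_one hp0]; exact hp
  have hmeas : Measurable fun s : ℝ => (1 - |s| ^ q) ^ (-(1 / p)) := by fun_prop
  have hpos : IntervalIntegrable (fun s : ℝ => (1 - |s| ^ q) ^ (-(1 / p))) volume 0 1 := by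
    have h := (intervalIntegral.intervalIntegrable_rpow' (a := 0) (b := 1)
      (r := -(1 / p)) (by linarith)).comp_sub_left 1
    simp only [sub_zero, sub_self] at h
    refine h.symm.mono_fun' hmeas.aestronglyMeasurable ?_
    rw [uIoc_of_le zero_le_one]
    filter_upwards [ae_restrict_mem measurableSet_Ioc] with s hs
    rw [abs_of_pos hs.1]
    rcases hs.2.eq_or_lt with rfl | hs1
    · simpa using (abs_of_nonneg (zero_rpow_nonneg (-p⁻¹))).le
    · have hle : s ^ q ≤ s := by
        simpa using rpow_le_rpow_of_exponent_ge hs.1 hs.2 hq.le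
      rw [norm_of_nonneg (rpow_nonneg (by linarith) _)]
      exact rpow_le_rpow_of_nonpos (by linarith) (by linarith)
        (by have : 0 < 1 / p := by positivity
            linarith)
  have hneg : IntervalIntegrable (fun s : ℝ => (1 - |s| ^ q) ^ (-(1 / p))) volume (-1) 0 := by
    have h := hpos.comp_sub_left 0
    simp only [zero_sub, abs_neg, neg_zero] at h
    exact h.symm
  exact hneg.trans hpos

lemma continuousOn_arcsinOdd {p q : ℝ} (hp : 1 < p) (hq : 1 < q) :
    ContinuousOn (arcsinOdd p q) (Icc (-1) 1) := by
  have h := intervalIntegral.continuousOn_primitive_interval' (a := 0)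
    (intervalIntegrable_arcsinOdd hp hq) (by rw [uIcc_of_le (by norm_num)]; norm_num)
  rwa [uIcc_of_le (by norm_num)] at h

lemma abs_rpow_lt_one {q σ : ℝ} (hq : 1 < q) (hσ : σ ∈ Ioo (-1:ℝ) 1) : |σ| ^ q < 1 :=
  rpow_lt_one (abs_nonneg σ) (abs_lt.2 hσ) (by linarith)

lemma hasDerivAt_arcsinOdd {p q σ : ℝ} (hp : 1 < p) (hq : 1 < q) (hσ : σ ∈ Ioo (-1:ℝ) 1) :
    HasDerivAt (arcsinOdd p q) ((1 - |σ| ^ q) ^ (-(1 / p))) σ := by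
  have hmeas : Measurable fun s : ℝ => (1 - |s| ^ q) ^ (-(1 / p)) := by fun_prop
  refine intervalIntegral.integral_hasDerivAt_right
    ((intervalIntegrable_arcsinOdd hp hq).mono_set ?_)
    hmeas.stronglyMeasurable.stronglyMeasurableAtFilter ?_
  · rw [uIcc_of_le (show (-1:ℝ) ≤ 1 by norm_num)]
    exact uIcc_subset_Icc (by norm_num) (Ioo_subset_Icc_self hσ)
  · refine ContinuousAt.rpow_const ?_ (Or.inl ?_)
    · exact continuousAt_const.sub
        (continuous_abs.continuousAt.rpow_const (Or.inr (by linarith)))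
    · have := abs_rpow_lt_one hq hσ
      linarith

lemma strictMonoOn_arcsinOdd {p q : ℝ} (hp : 1 < p) (hq : 1 < q) :
    StrictMonoOn (arcsinOdd p q) (Icc (-1) 1) := by
  refine strictMonoOn_of_deriv_pos (convex_Icc _ _) (continuousOn_arcsinOdd hp hq) fun x hx => ?_
  rw [interior_Icc] at hx
  rw [(hasDerivAt_arcsinOdd hp hq hx).deriv]
  have := abs_rpow_lt_one hq hx
  exact rpow_pos_of_pos (by linarith) _

lemma arcsinOdd_image {p q : ℝ} (hp : 1 < p) (hq : 1 < q) :
    arcsinOdd p q '' Icc (-1) 1 = Icc (-(piPQ p q / 2)) (piPQ p q / 2) := by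
  have h1 := arcsinOdd_one p q
  have hm := (strictMonoOn_arcsinOdd hp hq).monotoneOn
  have hsub := intermediate_value_Icc (show (-1:ℝ) ≤ 1 by norm_num) (continuousOn_arcsinOdd hp hq)
  rw [arcsinOdd_neg, h1] at hsub
  refine Subset.antisymm ?_ hsub
  rintro _ ⟨x, hx, rfl⟩
  rw [← h1, ← arcsinOdd_neg]
  exact ⟨hm ⟨le_rfl, by norm_num⟩ hx hx.1, hm hx ⟨by norm_num, le_rfl⟩ hx.2⟩

lemma piPQ_pos {p q : ℝ} (hp : 1 < p) (hq : 1 < q) : 0 < piPQ p q := by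
  have h := strictMonoOn_arcsinOdd hp hq (show (0:ℝ) ∈ Icc (-1:ℝ) 1 by norm_num)
    (show (1:ℝ) ∈ Icc (-1:ℝ) 1 by norm_num) one_pos
  rw [arcsinOdd_eq zero_le_one] at h
  simp only [arcsinOdd, intervalIntegral.integral_same] at h
  rw [piPQ]
  linarith

section Sine

variable {p q : ℝ} {S : ℝ → ℝ}

lemma leftInvOn_arcsinOdd (hinv : ∀ σ ∈ Icc (0:ℝ) 1, S (arcsinPQ p q σ) = σ)
    (hodd : ∀ t : ℝ, S (-t) = -S t) : LeftInvOn S (arcsinOdd p q) (Icc (-1) 1) := by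
  intro σ hσ
  rcases le_total 0 σ with h | h
  · rw [arcsinOdd_eq h]
    exact hinv σ ⟨h, hσ.2⟩
  · have h' := hinv (-σ) ⟨by linarith, by linarith [hσ.1]⟩
    rw [← arcsinOdd_eq (by linarith), arcsinOdd_neg, hodd] at h'
    linarith

lemma sine_antiperiodic (hpi : 0 < piPQ p q)
    (hrefl : ∀ t ∈ Icc (piPQ p q / 2) (piPQ p q), S t = S (piPQ p q - t))
    (hodd : ∀ t : ℝ, S (-t) = -S t) (hper : ∀ t : ℝ, S (t + 2 * piPQ p q) = S t) (t : ℝ) :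
    S (t + 2 * (piPQ p q / 2)) = -S t := by
  have hcancel : 2 * (piPQ p q / 2) = piPQ p q := by ring
  rw [hcancel]
  have hpos : ∀ t ∈ Icc 0 (piPQ p q), S (piPQ p q - t) = S t := by
    intro t ht
    rcases le_total t (piPQ p q / 2) with h | h
    · have := hrefl (piPQ p q - t) ⟨by linarith, by linarith [ht.1]⟩
      rwa [sub_sub_cancel] at this
    · exact (hrefl t ⟨h, ht.2⟩).symm
  have hper' : Function.Periodic (fun t => S (t + piPQ p q) = -S t) (2 * piPQ p q) := by
    intro t
    simp only [hper, add_right_comm t (2 * piPQ p q)]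
  obtain ⟨y, hy, h⟩ := hper'.exists_mem_Ico (by linarith) t (-piPQ p q)
  refine (iff_of_eq h).2 ?_
  rcases le_total y 0 with h0 | h0
  · have := hpos (-y) ⟨by linarith, by linarith [hy.1]⟩
    rw [hodd, sub_neg_eq_add, add_comm] at this
    exact this
  · have h1 := hpos y ⟨h0, by linarith [hy.2]⟩
    have h2 := hper (y - piPQ p q)
    have h3 := hodd (piPQ p q - y)
    rw [neg_sub] at h3
    rw [show y - piPQ p q + 2 * piPQ p q = y + piPQ p q by ring, h3, h1] at h2
    exact h2

lemma sine_half_pi (hS : LeftInvOn S (arcsinOdd p q) (Icc (-1) 1)) :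
    S (piPQ p q / 2) = 1 ∧ S (-(piPQ p q / 2)) = -1 := by
  rw [← arcsinOdd_one, ← arcsinOdd_neg]
  exact ⟨hS ⟨by norm_num, le_rfl⟩, hS ⟨le_rfl, by norm_num⟩⟩

lemma deriv_sine_antiperiodic (hanti : ∀ t, S (t + 2 * (piPQ p q / 2)) = -S t) (t : ℝ) :
    deriv S (t + 2 * (piPQ p q / 2)) = -deriv S t := by
  rw [← deriv_comp_add_const]
  simp only [hanti]
  exact deriv.fun_neg

lemma sine_mem_Ioo (hp : 1 < p) (hq : 1 < q)
    (hS : LeftInvOn S (arcsinOdd p q) (Icc (-1) 1))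
    {t : ℝ} (ht : t ∈ Ioo (-(piPQ p q / 2)) (piPQ p q / 2)) :
    S t ∈ Ioo (-1:ℝ) 1 ∧ arcsinOdd p q (S t) = t := by
  have h := Ioo_subset_Icc_self ht
  rw [← arcsinOdd_image hp hq] at h
  obtain ⟨σ, hσ, rfl⟩ := h
  have h1 := arcsinOdd_one p q
  rw [hS hσ]
  refine ⟨⟨lt_of_le_of_ne hσ.1 ?_, lt_of_le_of_ne hσ.2 ?_⟩, rfl⟩
  · rintro rfl
    rw [arcsinOdd_neg, h1] at ht
    exact lt_irrefl _ ht.1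
  · rintro rfl
    rw [h1] at ht
    exact lt_irrefl _ ht.2

lemma sine_continuousOn (hp : 1 < p) (hq : 1 < q)
    (hS : LeftInvOn S (arcsinOdd p q) (Icc (-1) 1)) :
    ContinuousOn S (Icc (-(piPQ p q / 2)) (piPQ p q / 2)) := by
  rw [← arcsinOdd_image hp hq]
  exact isCompact_Icc.continuousOn_image_of_leftInvOn (continuousOn_arcsinOdd hp hq) hS

lemma one_sub_abs_sine_rpow_nonneg (hp : 1 < p) (hq : 1 < q)
    (hS : LeftInvOn S (arcsinOdd p q) (Icc (-1) 1))
    {t : ℝ} (ht : t ∈ Icc (-(piPQ p q / 2)) (piPQ p q / 2)) :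
    0 ≤ 1 - |S t| ^ q := by
  rw [← arcsinOdd_image hp hq] at ht
  obtain ⟨σ, hσ, rfl⟩ := ht
  rw [hS hσ]
  have := rpow_le_one (abs_nonneg σ) (abs_le.2 hσ) (show 0 ≤ q by linarith)
  linarith

lemma continuousOn_one_sub_abs_sine_rpow (hp : 1 < p) (hq : 1 < q)
    (hS : LeftInvOn S (arcsinOdd p q) (Icc (-1) 1))
    {r : ℝ} (hr : 0 ≤ r) :
    ContinuousOn (fun t => (1 - |S t| ^ q) ^ r) (Icc (-(piPQ p q / 2)) (piPQ p q / 2)) :=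
  (continuousOn_const.sub ((sine_continuousOn hp hq hS).abs.rpow_const
    fun _ _ => Or.inr (by linarith))).rpow_const fun _ _ => Or.inr hr

lemma sine_hasDerivAt_Ioo (hp : 1 < p) (hq : 1 < q)
    (hS : LeftInvOn S (arcsinOdd p q) (Icc (-1) 1))
    {t : ℝ} (ht : t ∈ Ioo (-(piPQ p q / 2)) (piPQ p q / 2)) :
    HasDerivAt S ((1 - |S t| ^ q) ^ (1 / p)) t := by
  obtain ⟨hσ, hA⟩ := sine_mem_Ioo hp hq hS ht
  have hpos : 0 < 1 - |S t| ^ q := by linarith [abs_rpow_lt_one hq hσ]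
  have h := HasDerivAt.of_local_left_inverse (a := t) (g := S)
    ((sine_continuousOn hp hq hS).continuousAt (Icc_mem_nhds ht.1 ht.2))
    (hasDerivAt_arcsinOdd hp hq hσ) (rpow_pos_of_pos hpos _).ne' (by
      filter_upwards [Ioo_mem_nhds ht.1 ht.2] with y hy using (sine_mem_Ioo hp hq hS hy).2)
  rwa [← rpow_neg hpos.le, neg_neg] at h

lemma sine_hasDerivAt_Icc (hp : 1 < p) (hq : 1 < q)
    (hS : LeftInvOn S (arcsinOdd p q) (Icc (-1) 1))
    (hanti : ∀ t, S (t + 2 * (piPQ p q / 2)) = -S t) :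
    ∀ t ∈ Icc (-(piPQ p q / 2)) (piPQ p q / 2), HasDerivAt S ((1 - |S t| ^ q) ^ (1 / p)) t := by
  have hpi := piPQ_pos hp hq
  have hp0 : 0 < 1 / p := by
    have : (0:ℝ) < p := by linarith
    positivity
  have hc := continuousOn_one_sub_abs_sine_rpow hp hq hS hp0.le
  refine hasDerivAt_of_antiperiodic_of_Icc (by linarith) hanti
    (hasDerivWithinAt_Icc_of_Ioo (by linarith) (sine_continuousOn hp hq hS)
      (fun t ht => sine_hasDerivAt_Ioo hp hq hS ht)
      (hc _ ⟨le_rfl, by linarith⟩) (hc _ ⟨by linarith, le_rfl⟩)) ?_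
  obtain ⟨h1, h2⟩ := sine_half_pi hS
  rw [h1, h2]
  simp only [abs_neg, abs_one, one_rpow, sub_self, zero_rpow hp0.ne', neg_zero]

lemma sine_hasDerivAt (hp : 1 < p) (hq : 1 < q)
    (hS : LeftInvOn S (arcsinOdd p q) (Icc (-1) 1))
    (hanti : ∀ t, S (t + 2 * (piPQ p q / 2)) = -S t) (t : ℝ) :
    HasDerivAt S (deriv S t) t := by
  have hpi := piPQ_pos hp hq
  refine hasDerivAt_of_antiperiodic (H := piPQ p q / 2) (by linarith) hanti
    (deriv_sine_antiperiodic hanti) (fun t ht => ?_) t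
  exact (sine_hasDerivAt_Icc hp hq hS hanti t ht).differentiableAt.hasDerivAt

lemma phi_deriv_sine_hasDerivAt (hp : 1 < p) (hq : 1 < q)
    (hS : LeftInvOn S (arcsinOdd p q) (Icc (-1) 1))
    (hanti : ∀ t, S (t + 2 * (piPQ p q / 2)) = -S t) (t : ℝ) :
    HasDerivAt (fun s => phi p (deriv S s)) (-(q * (1 - 1 / p) * phi q (S t))) t := by
  have hpi := piPQ_pos hp hq
  have hr : 0 < 1 - 1 / p := by
    have : 1 / p < 1 := by rw [div_lt_one (by linarith)]; exact hp
    linarith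
  have heq : EqOn (fun s => phi p (deriv S s)) (fun t => (1 - |S t| ^ q) ^ (1 - 1 / p))
      (Icc (-(piPQ p q / 2)) (piPQ p q / 2)) := fun s hs => by
    simp only [(sine_hasDerivAt_Icc hp hq hS hanti s hs).deriv]
    exact phi_rpow_inv hp (one_sub_abs_sine_rpow_nonneg hp hq hS hs)
  obtain ⟨h1, h2⟩ := sine_half_pi hS
  have hcont := sine_continuousOn hp hq hS
  have hanti' : ∀ s, phi p (deriv S (s + 2 * (piPQ p q / 2))) = -phi p (deriv S s) := fun s => by
    rw [deriv_sine_antiperiodic hanti, phi_neg]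
  refine hasDerivAt_of_antiperiodic (H := piPQ p q / 2) (g := fun s => -(q * (1 - 1 / p) * phi q (S s)))
    (by linarith) hanti' (fun s => by rw [hanti, phi_neg]; ring) ?_ t
  refine hasDerivAt_of_antiperiodic_of_Icc (by linarith) hanti'
    (hasDerivWithinAt_Icc_of_Ioo (by linarith)
      ((continuousOn_one_sub_abs_sine_rpow hp hq hS hr.le).congr heq) (fun s hs => ?_) ?_ ?_)
      (by rw [h1, h2, phi_neg]; ring)
  · obtain ⟨hσ, -⟩ := sine_mem_Ioo hp hq hS hs
    have hpos : 0 < 1 - |S s| ^ q := by linarith [abs_rpow_lt_one hq hσ]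
    have hd := (((hasDerivAt_abs_rpow (S s) hq).comp s
      (sine_hasDerivAt_Ioo hp hq hS hs)).const_sub 1).rpow_const
      (p := 1 - 1 / p) (Or.inl (by simpa using hpos.ne'))
    refine (hd.congr_of_eventuallyEq ?_).congr_deriv ?_
    · filter_upwards [Icc_mem_nhds hs.1 hs.2] with x hx using heq hx
    · have hmul : (1 - |S s| ^ q) ^ (1 / p) * (1 - |S s| ^ q) ^ (1 - 1 / p - 1) = 1 := by
        rw [← rpow_add hpos]
        simp
      simp only [Function.comp_apply]
      rw [phi_eq]
      linear_combination (-(q * |S s| ^ (q - 2) * S s * (1 - 1 / p))) * hmul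
  · refine ((ContinuousAt.comp_continuousWithinAt (continuousAt_phi q ?_)
      (hcont _ ⟨le_rfl, by linarith⟩)).const_mul _).neg
    rw [h2]
    norm_num
  · refine ((ContinuousAt.comp_continuousWithinAt (continuousAt_phi q ?_)
      (hcont _ ⟨by linarith, le_rfl⟩)).const_mul _).neg
    rw [h1]
    norm_num

end Sine

theorem stmt10 (p q lam α : ℝ) (hp : 1 < p) (hq : 1 < q) (hlam : 0 < lam) (hα : 0 < α)
    (sinpq : ℝ → ℝ)
    (hinv : ∀ σ ∈ Icc (0:ℝ) 1, sinpq (arcsinPQ p q σ) = σ)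
    (hrefl : ∀ t ∈ Icc (piPQ p q / 2) (piPQ p q), sinpq t = sinpq (piPQ p q - t))
    (hodd : ∀ t : ℝ, sinpq (-t) = - sinpq t)
    (hper : ∀ t : ℝ, sinpq (t + 2 * piPQ p q) = sinpq t) :
    let pstar := p / (p - 1)
    let R := (q / (lam * pstar)) ^ (1 / q) * α ^ (p / q)
    let u := fun t : ℝ => R * sinpq ((lam * pstar / q) ^ (1 / p) * R ^ (q / p - 1) * t)
    u 0 = 0 ∧
    ∃ u' : ℝ → ℝ, (∀ t : ℝ, HasDerivAt u (u' t) t) ∧ u' 0 = α ∧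
      ∀ t : ℝ, HasDerivAt (fun s => phi p (u' s)) (-(lam * phi q (u t))) t := by
  intro pstar R u
  have hp0 : 0 < p := by linarith
  have hp1 : 0 < p - 1 := by linarith
  have hq0 : 0 < q := by linarith
  have hps : 0 < pstar := div_pos hp0 hp1
  have hR : 0 < R := by positivity
  have hk : 0 < lam * pstar / q := by positivity
  set c := (lam * pstar / q) ^ (1 / p) * R ^ (q / p - 1) with hc_def
  have hc : 0 < c := by positivity
  have hS := leftInvOn_arcsinOdd hinv hodd
  have hpi := piPQ_pos hp hq
  have hanti := sine_antiperiodic hpi hrefl hodd hper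
  have h0 : sinpq 0 = 0 := by
    have := hodd 0
    rw [neg_zero] at this
    linarith
  have hlin : ∀ t : ℝ, HasDerivAt (fun t => c * t) c t := fun t => by
    simpa using (hasDerivAt_id t).const_mul c
  have hRc : R * c = α := by
    have hRq : R ^ (q / p) = (q / (lam * pstar)) ^ (1 / p) * α := by
      rw [mul_rpow (by positivity) (by positivity), ← rpow_mul (by positivity),
        ← rpow_mul hα.le, show 1 / q * (q / p) = 1 / p by field_simp,
        show p / q * (q / p) = 1 by field_simp, rpow_one]
    have hone : (lam * pstar / q) ^ (1 / p) * (q / (lam * pstar)) ^ (1 / p) = 1 := by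
      rw [← mul_rpow (by positivity) (by positivity),
        show lam * pstar / q * (q / (lam * pstar)) = 1 by field_simp, one_rpow]
    rw [hc_def, rpow_sub_one hR.ne', hRq]
    field_simp
    linear_combination hone
  have hconst : (R * c) ^ (p - 1) * (q * (1 - 1 / p) * c) = lam * R ^ (q - 1) := by
    have hcp : c ^ (p - 1) * c = lam * pstar / q * R ^ (q - p) := by
      rw [← rpow_add_one hc.ne', sub_add_cancel, hc_def, mul_rpow (by positivity) (by positivity),
        ← rpow_mul hk.le, ← rpow_mul hR.le, show 1 / p * p = 1 by field_simp, rpow_one,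
        show (q / p - 1) * p = q - p by field_simp]
    have hRR : R ^ (p - 1) * R ^ (q - p) = R ^ (q - 1) := by
      rw [← rpow_add hR]
      congr 1
      ring
    have hpq : q * (1 - 1 / p) * (lam * pstar / q) = lam := by
      simp only [pstar]
      field_simp
    rw [mul_rpow hR.le hc.le, ← hRR]
    linear_combination (R ^ (p - 1) * (q * (1 - 1 / p))) * hcp +
      (R ^ (p - 1) * R ^ (q - p)) * hpq
  refine ⟨by simp [u, h0], fun t => R * c * deriv sinpq (c * t), fun t => ?_, ?_, fun t => ?_⟩
  · refine (((sine_hasDerivAt hp hq hS hanti (c * t)).comp t (hlin t)).const_mul R).congr_deriv ?_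
    ring
  · have hd := sine_hasDerivAt_Icc hp hq hS hanti 0 ⟨by linarith, by linarith⟩
    simp only [mul_zero, hd.deriv, h0, abs_zero, zero_rpow hq0.ne', sub_zero, one_rpow, mul_one]
    exact hRc
  · simp only [phi_mul_of_pos p _ (mul_pos hR hc), u, phi_mul_of_pos q _ hR]
    refine (((phi_deriv_sine_hasDerivAt hp hq hS hanti (c * t)).comp t
      (hlin t)).const_mul ((R * c) ^ (p - 1))).congr_deriv ?_
    linear_combination (-phi q (sinpq (c * t))) * hconst
end
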